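/- Let K_n=(V,E⁺,E⁻) be a complete signed graph that is (weakly) k-balanced with positive components V_1,…,V_k, |V_1| ≥ … ≥ |V_k|. Then the largest component V_1 is an offensive alliance of K_n. -/

import Mathlib

/-- A signed graph on a vertex type `V`: a set of positive edges and a set of
negative edges, given as two simple graphs with disjoint edge sets. -/
structure SignedGraph (V : Type*) where
  pos : SimpleGraph V
  neg : SimpleGraph V
  disj : ∀ u v : V, ¬ (pos.Adj u v ∧ neg.Adj u v)

namespace SignedGraph

variable {V : Type*}

/-- The positive neighborhood `N⁺(v)`. -/
def Np (G : SignedGraph V) (v : V) : Set V := {u | G.pos.Adj v u}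

/-- The negative neighborhood `N⁻(v)`. -/
def Nn (G : SignedGraph V) (v : V) : Set V := {u | G.neg.Adj v u}

/-- The (open) neighborhood `N(v) = N⁺(v) ∪ N⁻(v)`. -/
def Nbr (G : SignedGraph V) (v : V) : Set V := G.Np v ∪ G.Nn v

/-- The positive degree `deg⁺(v)`. -/
noncomputable def degp (G : SignedGraph V) (v : V) : ℕ := (G.Np v).ncard

/-- The negative degree `deg⁻(v)`. -/
noncomputable def degn (G : SignedGraph V) (v : V) : ℕ := (G.Nn v).ncard

/-- The positive degree with respect to a set `S`: `deg⁺_S(v) = |N⁺(v) ∩ S|`. -/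
noncomputable def degpIn (G : SignedGraph V) (S : Set V) (v : V) : ℕ := (G.Np v ∩ S).ncard

/-- The negative degree with respect to a set `S`: `deg⁻_S(v) = |N⁻(v) ∩ S|`. -/
noncomputable def degnIn (G : SignedGraph V) (S : Set V) (v : V) : ℕ := (G.Nn v ∩ S).ncard

/-- The boundary `∂S = (⋃_{v ∈ S} N(v)) \ S`. -/
def boundary (G : SignedGraph V) (S : Set V) : Set V := (⋃ v ∈ S, G.Nbr v) \ S

/-- `S` is an offensive alliance: every boundary vertex `v` satisfies
`deg⁻_S(v) ≥ deg⁺_S(v)` and `deg⁻_S(v) ≥ deg⁺_{S̄}(v) + 1`. -/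
def IsOffensive (G : SignedGraph V) (S : Set V) : Prop :=
  ∀ v ∈ G.boundary S,
    G.degpIn S v ≤ G.degnIn S v ∧ G.degpIn Sᶜ v + 1 ≤ G.degnIn S v

/-- The offensive alliance number `a_so(G)`: the least size of a nonempty offensive alliance. -/
noncomputable def aso (G : SignedGraph V) : ℕ :=
  sInf {n | ∃ S : Set V, S.Nonempty ∧ G.IsOffensive S ∧ S.ncard = n}

/-- `S` is a minimum-size nonempty offensive alliance. -/
def IsMinOffensive (G : SignedGraph V) (S : Set V) : Prop :=
  S.Nonempty ∧ G.IsOffensive S ∧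
    ∀ T : Set V, T.Nonempty → G.IsOffensive T → S.ncard ≤ T.ncard

/-- The minimum positive degree `δ⁺(G)`. -/
noncomputable def minPosDeg (G : SignedGraph V) : ℕ := sInf (Set.range G.degp)

/-- The maximum negative degree `Δ⁻(G)`. -/
noncomputable def maxNegDeg (G : SignedGraph V) : ℕ := sSup (Set.range G.degn)

/-- The underlying unsigned graph `(V, E⁺ ∪ E⁻)`. -/
def underlying (G : SignedGraph V) : SimpleGraph V := G.pos ⊔ G.neg

/-- `G` is connected if its underlying unsigned graph is connected. -/
def Connected (G : SignedGraph V) : Prop := G.underlying.Connected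

/-- `G` is a complete signed graph that is (weakly) `k`-balanced with positive components
`P 0, …, P (k-1)`: the `P i` are nonempty, pairwise disjoint, cover `V`, the positive edges
are exactly the pairs of distinct vertices inside a common part, and the negative edges are
exactly the pairs of distinct vertices in no common part. -/
def IsKBalanced (G : SignedGraph V) (k : ℕ) (P : Fin k → Set V) : Prop :=
  (∀ i, (P i).Nonempty) ∧
  (∀ i j : Fin k, i ≠ j → Disjoint (P i) (P j)) ∧
  (⋃ i, P i) = Set.univ ∧
  (∀ u v : V, G.pos.Adj u v ↔ u ≠ v ∧ ∃ i, u ∈ P i ∧ v ∈ P i) ∧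
  (∀ u v : V, G.neg.Adj u v ↔ u ≠ v ∧ ¬ ∃ i, u ∈ P i ∧ v ∈ P i)

/-- `G` is a complete signed graph that is (weakly) `k`-anti-balanced with negative components
`P 0, …, P (k-1)`. -/
def IsKAntiBalanced (G : SignedGraph V) (k : ℕ) (P : Fin k → Set V) : Prop :=
  (∀ i, (P i).Nonempty) ∧
  (∀ i j : Fin k, i ≠ j → Disjoint (P i) (P j)) ∧
  (⋃ i, P i) = Set.univ ∧
  (∀ u v : V, G.neg.Adj u v ↔ u ≠ v ∧ ∃ i, u ∈ P i ∧ v ∈ P i) ∧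
  (∀ u v : V, G.pos.Adj u v ↔ u ≠ v ∧ ¬ ∃ i, u ∈ P i ∧ v ∈ P i)

/-- `V` can be partitioned into `t` classes such that vertices in a common class have the same
positive neighborhoods and the same negative neighborhoods (up to each other). -/
def GoodSndPartition (G : SignedGraph V) (t : ℕ) : Prop :=
  ∃ C : Fin t → Set V,
    (⋃ i, C i) = Set.univ ∧
    (∀ i j : Fin t, i ≠ j → Disjoint (C i) (C j)) ∧
    ∀ i : Fin t, ∀ u ∈ C i, ∀ v ∈ C i,
      G.Np v \ {u} = G.Np u \ {v} ∧ G.Nn v \ {u} = G.Nn u \ {v}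

/-- The signed neighborhood diversity `snd(G)`. -/
noncomputable def snd (G : SignedGraph V) : ℕ := sInf {t | G.GoodSndPartition t}

/-- The signed subgraph induced on a set `W` of vertices. -/
def restrict (G : SignedGraph V) (W : Set V) : SignedGraph W where
  pos := G.pos.induce W
  neg := G.neg.induce W
  disj := fun u v h => G.disj u.val v.val h

end SignedGraph

namespace SignedGraph

variable {V : Type*} {G : SignedGraph V} {k : ℕ} {P : Fin k → Set V}

/-- In a balanced complete signed graph a vertex lies in exactly one part. -/
theorem IsKBalanced.eq_of_mem (h : G.IsKBalanced k P) {v : V} {i j : Fin k}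
    (hi : v ∈ P i) (hj : v ∈ P j) : i = j := by
  by_contra hij
  exact Set.disjoint_left.mp (h.2.1 i j hij) hi hj

/-- The positive neighbors of a vertex are the other vertices of its part. -/
theorem IsKBalanced.Np_eq (h : G.IsKBalanced k P) {v : V} {j : Fin k} (hv : v ∈ P j) :
    G.Np v = P j \ {v} := by
  ext u
  simp only [Np, Set.mem_ofPred_eq, h.2.2.2.1, Set.mem_sdiff, Set.mem_singleton_iff]
  constructor
  · rintro ⟨hne, i, hvi, hui⟩
    exact ⟨h.eq_of_mem hvi hv ▸ hui, hne.symm⟩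
  · rintro ⟨hu, hne⟩
    exact ⟨Ne.symm hne, j, hv, hu⟩

/-- The negative neighbors of a vertex are the vertices outside its part. -/
theorem IsKBalanced.Nn_eq (h : G.IsKBalanced k P) {v : V} {j : Fin k} (hv : v ∈ P j) :
    G.Nn v = (P j)ᶜ := by
  ext u
  simp only [Nn, Set.mem_ofPred_eq, h.2.2.2.2, Set.mem_compl_iff]
  constructor
  · rintro ⟨-, hn⟩ hu
    exact hn ⟨j, hv, hu⟩
  · intro hu
    refine ⟨fun e => hu (e ▸ hv), ?_⟩
    rintro ⟨i, hvi, hui⟩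
    exact hu (h.eq_of_mem hvi hv ▸ hui)

/-- A part that is at least as large as every other part is an offensive alliance. -/
theorem IsKBalanced.isOffensive_of_forall_ncard_le [Finite V] (h : G.IsKBalanced k P)
    {i : Fin k} (hi : ∀ j, (P j).ncard ≤ (P i).ncard) : G.IsOffensive (P i) := by
  rintro v ⟨-, hv⟩
  obtain ⟨j, hj⟩ := Set.mem_iUnion.mp (h.2.2.1 ▸ Set.mem_univ v)
  have hdisj : Disjoint (P i) (P j) := h.2.1 i j (fun e => hv (e ▸ hj))
  have hneg : (P j)ᶜ ∩ P i = P i :=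
    Set.inter_eq_right.mpr hdisj.subset_compl_right
  have hpos : (P j \ {v}) ∩ P i = ∅ :=
    (hdisj.symm.mono_left Set.sdiff_subset).inter_eq
  rw [degpIn, degpIn, degnIn, h.Np_eq hj, h.Nn_eq hj, hneg, hpos]
  refine ⟨by simp, ?_⟩
  calc ((P j \ {v}) ∩ (P i)ᶜ).ncard + 1
      ≤ (P j \ {v}).ncard + 1 := by
        gcongr
        · exact Set.toFinite _
        · exact Set.inter_subset_left
    _ = (P j).ncard := Set.ncard_sdiff_singleton_add_one hj
    _ ≤ (P i).ncard := hi j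

end SignedGraph

theorem signed_balanced_largest_part_offensive {V : Type*} [Fintype V]
    (G : SignedGraph V) (k : ℕ) (hk : 1 ≤ k) (P : Fin k → Set V)
    (hbal : G.IsKBalanced k P)
    (hsort : ∀ i j : Fin k, i ≤ j → (P j).ncard ≤ (P i).ncard) :
    G.IsOffensive (P ⟨0, hk⟩) := by
  exact hbal.isOffensive_of_forall_ncard_le fun j => hsort _ j (Fin.mk_le_of_le_val (Nat.zero_le _))
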